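/- Let T be the q^{d(n+1)} × q^{n+d} incidence matrix between all varieties V_{a_1,...,a_d} and all points of F_q^{n+d} (with T(V,p) = 1 iff p ∈ V). Then the matrix T* T has eigenvalue q^{(d+1)n} with multiplicity 1, eigenvalue q^{dn} with multiplicity q^{n+d} − q^n, and eigenvalue 0 with multiplicity q^n − 1. -/

import Mathlib

theorem aux_pow_inj {F : Type*} [Field F] [Fintype F] (b : ℕ) (h0 : 0 < b)
    (hb : Nat.Coprime b (Fintype.card F - 1)) (x y : F) (h : x ^ b = y ^ b) : x = y := by
  classical
  by_cases hx : x = 0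
  · subst hx
    rw [zero_pow h0.ne'] at h
    exact (pow_eq_zero_iff h0.ne' |>.1 h.symm).symm
  by_cases hy : y = 0
  · subst hy
    rw [zero_pow h0.ne'] at h
    exact (pow_eq_zero_iff h0.ne' |>.1 h)
  have h1 : (x / y) ^ b = 1 := by
    rw [div_pow, h, div_self (pow_ne_zero _ hy)]
  have h2 : (x / y) ^ (Fintype.card F - 1) = 1 :=
    FiniteField.pow_card_sub_one_eq_one _ (div_ne_zero hx hy)
  have h3 : orderOf (x / y) ∣ 1 := by
    rw [← hb]
    exact Nat.dvd_gcd (orderOf_dvd_of_pow_eq_one h1) (orderOf_dvd_of_pow_eq_one h2)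
  have h4 : x / y = 1 := orderOf_eq_one_iff.1 (Nat.dvd_one.1 h3)
  exact (div_eq_one_iff_eq hy).1 h4

theorem aux_count {F : Type*} [Field F] [Fintype F] [DecidableEq F] (n : ℕ)
    (v : Fin n → F) (hv : v ≠ 0) (w : F) :
    (∑ α : Fin n → F, if ∑ j, α j * v j = w then (1 : ℂ) else 0)
      = (Fintype.card F : ℂ) ^ n / Fintype.card F := by
  obtain ⟨k, hk⟩ := Function.ne_iff.1 hv
  have hk : v k ≠ 0 := hk
  have key : ∀ w', (∑ α : Fin n → F, if ∑ j, α j * v j = w' then (1 : ℂ) else 0)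
      = ∑ α : Fin n → F, if ∑ j, α j * v j = w then (1 : ℂ) else 0 := by
    intro w'
    refine Fintype.sum_equiv (Equiv.addRight (Pi.single k ((w - w') / v k))) _ _ ?_
    intro α
    have : ∑ j, (α + (Pi.single k ((w - w') / v k) : Fin n → F)) j * v j = ∑ j, α j * v j + (w - w') := by
      simp only [Pi.add_apply, add_mul, Finset.sum_add_distrib]
      congr 1
      rw [Finset.sum_eq_single k]
      · simp [hk]
      · intro j _ hj; simp [hj]
      · simp
    simp only [Equiv.coe_addRight, this]
    congr 1
    rw [eq_iff_iff]
    constructor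
    · intro h; rw [h]; ring
    · intro h; linear_combination h
  have hq : (Fintype.card F : ℂ) ≠ 0 := by exact_mod_cast Fintype.card_ne_zero
  rw [eq_div_iff hq]
  have : ∑ w' : F, (∑ α : Fin n → F, if ∑ j, α j * v j = w' then (1 : ℂ) else 0)
      = (Fintype.card F : ℂ) ^ n := by
    rw [Finset.sum_comm]
    simp
  rw [← this, Finset.sum_congr rfl (fun w' _ => key w')]
  simp [mul_comm]

theorem aux_count2 {F : Type*} [Field F] [Fintype F] [DecidableEq F] (n : ℕ)
    (u u' : Fin n → F) (y y' H H' : F) :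
    (∑ a : (Fin n → F) × F, (if y = H + ∑ j, a.1 j * u j + a.2 then (1 : ℂ) else 0) *
      (if y' = H' + ∑ j, a.1 j * u' j + a.2 then (1 : ℂ) else 0))
      = ∑ α : Fin n → F, if ∑ j, α j * (u - u') j = (y - H) - (y' - H') then (1 : ℂ) else 0 := by
  rw [Fintype.sum_prod_type]
  refine Finset.sum_congr rfl fun α _ => ?_
  rw [Finset.sum_eq_single (y - H - ∑ j, α j * u j)]
  · have : ∑ j, α j * (u - u') j = ∑ j, α j * u j - ∑ j, α j * u' j := by
      simp [mul_sub]
    rw [this, if_pos (by ring), one_mul]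
    congr 1
    rw [eq_iff_iff]
    constructor <;> intro h <;> linear_combination h
  · intro c _ hc
    rw [if_neg, zero_mul]
    intro h
    apply hc
    simp only at h
    rw [h]; ring
  · simp

theorem aux_charpoly {X Y : Type*} [Fintype X] [Fintype Y] [DecidableEq X] [DecidableEq Y]
    [Nonempty X] [Nonempty Y] (e c : ℂ) (hc : e * Fintype.card Y = c)
    (M : Matrix (X × Y) (X × Y) ℂ)
    (hM : ∀ p p', M p p' = if p.1 = p'.1 then (if p.2 = p'.2 then c else 0) else e) :
    M.charpoly = (Polynomial.X - Polynomial.C (c * Fintype.card X)) *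
      (Polynomial.X - Polynomial.C c) ^ (Fintype.card X * Fintype.card Y - Fintype.card X) *
      Polynomial.X ^ (Fintype.card X - 1) := by
  let U : Matrix (X × Y) X ℂ := Matrix.of fun p x => if p.1 = x then 0 else e
  let V : Matrix X (X × Y) ℂ := Matrix.of fun x p => if x = p.1 then 1 else 0
  have h1 : M = U * V - Matrix.scalar _ (-c) := by
    ext p p'
    rw [hM]
    simp only [Matrix.sub_apply, Matrix.mul_apply, U, V, Matrix.of_apply, Matrix.scalar_apply,
      Matrix.diagonal_apply, Prod.ext_iff]
    simp
    split_ifs <;> simp_all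
  have h2 : V * U = Matrix.vecMulVec (fun _ => c) (fun _ => 1) - Matrix.scalar _ c := by
    ext x x'
    simp only [Matrix.sub_apply, Matrix.mul_apply, U, V, Matrix.of_apply, Matrix.scalar_apply,
      Matrix.diagonal_apply, Matrix.vecMulVec_apply, Fintype.sum_prod_type]
    rw [Finset.sum_eq_single x]
    · simp
      split_ifs <;> simp [← hc, mul_comm]
    · intro z _ hz
      simp [Ne.symm hz]
    · simp
  have hcard : Fintype.card X ≤ Fintype.card (X × Y) := by
    rw [Fintype.card_prod]
    exact Nat.le_mul_of_pos_right _ Fintype.card_pos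
  rw [h1, Matrix.charpoly_sub_scalar, Matrix.charpoly_mul_comm_of_le _ _ hcard, h2,
    Matrix.charpoly_sub_scalar, Matrix.charpoly_vecMulVec]
  obtain ⟨m, hm⟩ : ∃ m, Fintype.card X = m + 1 :=
    ⟨Fintype.card X - 1, by have := Fintype.card_pos (α := X); omega⟩
  have h3 : ((fun _ : X => c) ⬝ᵥ fun _ => (1 : ℂ)) = c * Fintype.card X := by
    simp [dotProduct, mul_comm]
  rw [h3, Fintype.card_prod, Polynomial.smul_eq_C_mul, hm]
  simp only [Polynomial.mul_comp, Polynomial.sub_comp, Polynomial.pow_comp, Polynomial.X_comp,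
    Polynomial.C_comp, Polynomial.add_comp, Polynomial.C_neg, Nat.add_sub_cancel]
  ring

/-- The matrix `T* T`, where `T` is the variety–point incidence matrix, has eigenvalue
`q^{(d+1)n}` with multiplicity `1`, eigenvalue `q^{dn}` with multiplicity `q^{n+d} − q^n`,
and eigenvalue `0` with multiplicity `q^n − 1` (stated via its characteristic polynomial). -/
theorem stmt_5 {F : Type*} [Field F] [Fintype F] [DecidableEq F] (n d : ℕ)
    (hn : 1 ≤ n) (hd : 1 ≤ d)
    (h : Fin d → MvPolynomial (Fin n) F)
    (hdeg : ∀ i, (h i).totalDegree ≤ Fintype.card F - 1)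
    (b : Fin d → Fin n → ℕ)
    (hb : ∀ i j, 0 < b i j ∧ Nat.Coprime (b i j) (Fintype.card F - 1))
    (T : Matrix (Fin d → (Fin n → F) × F) ((Fin n → F) × (Fin d → F)) ℂ)
    (hT : ∀ (a : Fin d → (Fin n → F) × F) (pt : (Fin n → F) × (Fin d → F)),
      ((∀ i, pt.2 i = MvPolynomial.eval pt.1 (h i)
          + (∑ j, (a i).1 j * pt.1 j ^ (b i j)) + (a i).2) → T a pt = 1) ∧
      (¬ (∀ i, pt.2 i = MvPolynomial.eval pt.1 (h i)
          + (∑ j, (a i).1 j * pt.1 j ^ (b i j)) + (a i).2) → T a pt = 0)) :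
    (T.conjTranspose * T).charpoly =
      (Polynomial.X - Polynomial.C ((Fintype.card F : ℂ) ^ ((d + 1) * n)))
      * (Polynomial.X - Polynomial.C ((Fintype.card F : ℂ) ^ (d * n)))
          ^ (Fintype.card F ^ (n + d) - Fintype.card F ^ n)
      * Polynomial.X ^ (Fintype.card F ^ n - 1) := by
  have hq : (Fintype.card F : ℂ) ≠ 0 := by exact_mod_cast Fintype.card_ne_zero
  have hTe : ∀ a pt, T a pt = ∏ i, if pt.2 i = MvPolynomial.eval pt.1 (h i)
          + (∑ j, (a i).1 j * pt.1 j ^ (b i j)) + (a i).2 then (1 : ℂ) else 0 := by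
    intro a pt
    by_cases hh : ∀ i, pt.2 i = MvPolynomial.eval pt.1 (h i)
          + (∑ j, (a i).1 j * pt.1 j ^ (b i j)) + (a i).2
    · rw [(hT a pt).1 hh, Finset.prod_eq_one]
      intro i _
      rw [if_pos (hh i)]
    · rw [(hT a pt).2 hh]
      obtain ⟨i, hi⟩ := not_forall.1 hh
      rw [Finset.prod_eq_zero (Finset.mem_univ i)]
      rw [if_neg hi]
  have hstar : ∀ a pt, star (T a pt) = T a pt := by
    intro a pt
    rw [hTe]
    simp only [star_prod]
    refine Finset.prod_congr rfl fun i _ => ?_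
    split_ifs <;> simp
  have hent : ∀ p p', (T.conjTranspose * T) p p' = ∏ i, ∑ α : Fin n → F,
      if ∑ j, α j * ((fun j => p.1 j ^ b i j) - (fun j => p'.1 j ^ b i j)) j
        = (p.2 i - MvPolynomial.eval p.1 (h i)) - (p'.2 i - MvPolynomial.eval p'.1 (h i))
      then (1 : ℂ) else 0 := by
    intro p p'
    simp only [← aux_count2]
    rw [Matrix.mul_apply, Finset.prod_univ_sum, Fintype.piFinset_univ]
    refine Finset.sum_congr rfl fun a _ => ?_
    rw [Matrix.conjTranspose_apply, hstar, hTe, hTe, Finset.prod_mul_distrib]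
  have hM : ∀ p p', (T.conjTranspose * T) p p' = if p.1 = p'.1 then
      (if p.2 = p'.2 then (Fintype.card F : ℂ) ^ (d * n) else 0)
      else ((Fintype.card F : ℂ) ^ n / Fintype.card F) ^ d := by
    rintro ⟨x, y⟩ ⟨x', y'⟩
    rw [hent]
    by_cases hx : x = x'
    · subst hx
      simp only [sub_self, Pi.zero_apply, mul_zero, Finset.sum_const_zero, if_true]
      by_cases hy : y = y'
      · subst hy
        simp [← pow_mul, mul_comm]
      · obtain ⟨i, hi⟩ := Function.ne_iff.1 hy
        rw [if_neg hy]
        refine Finset.prod_eq_zero (Finset.mem_univ i) ?_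
        refine Finset.sum_eq_zero fun α _ => if_neg fun h0 => hi ?_
        linear_combination -h0
    · rw [if_neg hx]
      rw [Finset.prod_congr rfl fun i _ => aux_count n _ ?_ _]
      · simp [div_pow]
      · intro h0
        apply hx
        funext j
        exact aux_pow_inj (b i j) (hb i j).1 (hb i j).2 _ _ (sub_eq_zero.1 (congrFun h0 j))
  have := aux_charpoly _ ((Fintype.card F : ℂ) ^ (d * n)) ?_ _ hM
  · rw [this]
    simp only [Fintype.card_pi, Finset.prod_const, Finset.card_univ, Fintype.card_fin]
    rw [← pow_add]
    congr 4
    push_cast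
    rw [← pow_add]
    ring_nf
  · simp only [Fintype.card_pi, Finset.prod_const, Finset.card_univ, Fintype.card_fin]
    push_cast
    rw [← mul_pow, div_mul_cancel₀ _ hq, ← pow_mul, mul_comm]
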